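/- Let R be a discrete valuation ring with fraction field F, normalized discrete valuation v : F^× → ℤ, and residue field κ. Let u ∈ R^× be a unit whose image in κ is not a square in κ. Then for all x, y ∈ F with x² − u·y² ≠ 0, the integer v(x² − u·y²) is even. -/

import Mathlib

theorem exists_zpow_unit_aux
    (R F : Type) [CommRing R] [IsDomain R] [IsDiscreteValuationRing R]
    [Field F] [Algebra R F] [IsFractionRing R F]
    (π : R) (hπ : Irreducible π) (x : F) (hx : x ≠ 0) :
    ∃ (n : ℤ) (w : Rˣ), x = (algebraMap R F π) ^ n * algebraMap R F (w : R) := by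
  obtain ⟨a, b, hb, rfl⟩ := IsFractionRing.div_surjective (A := R) x
  have hb0 : b ≠ 0 := nonZeroDivisors.ne_zero hb
  have ha0 : a ≠ 0 := by
    rintro rfl
    simp at hx
  obtain ⟨m, v, rfl⟩ := IsDiscreteValuationRing.eq_unit_mul_pow_irreducible ha0 hπ
  obtain ⟨k, w, rfl⟩ := IsDiscreteValuationRing.eq_unit_mul_pow_irreducible hb0 hπ
  have hp : algebraMap R F π ≠ 0 := by
    simpa using hπ.ne_zero
  have hw : algebraMap R F (w : R) ≠ 0 := by
    simp
  have hww : algebraMap R F (w : R) * algebraMap R F ((w⁻¹ : Rˣ) : R) = 1 := by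
    rw [← map_mul]; simp
  refine ⟨(m : ℤ) - k, v * w⁻¹, ?_⟩
  rw [zpow_sub₀ hp, zpow_natCast, zpow_natCast]
  simp only [map_mul, map_pow, Units.val_mul]
  rw [div_mul_eq_mul_div, div_eq_div_iff (by positivity) (by positivity)]
  linear_combination (-(algebraMap R F (v : R) * algebraMap R F π ^ m * algebraMap R F π ^ k)) * hww

/-- Let `R` be a discrete valuation ring with fraction field `F` and residue field `κ`, and
let `u ∈ R^×` be a unit whose image in `κ` is not a square.  Then every nonzero value of the
form `x² - u·y²` with `x, y ∈ F` has even (normalized) valuation; equivalently, it can be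
written as `π^(2n) · w` with `π` a uniformizer of `R`, `n ∈ ℤ` and `w ∈ R^×`. -/
theorem even_valuation_of_norm_form
    (R F : Type) [CommRing R] [IsDomain R] [IsDiscreteValuationRing R]
    [Field F] [Algebra R F] [IsFractionRing R F]
    (π : R) (hπ : Irreducible π) (u : Rˣ)
    (hu : ¬ ∃ z : IsLocalRing.ResidueField R, z ^ 2 = IsLocalRing.residue R (u : R))
    (x y : F) (hxy : x ^ 2 - algebraMap R F (u : R) * y ^ 2 ≠ 0) :
    ∃ (n : ℤ) (w : Rˣ),
      x ^ 2 - algebraMap R F (u : R) * y ^ 2 =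
        (algebraMap R F π) ^ (2 * n) * algebraMap R F (w : R) := by
  have key : ∀ z : F, z ≠ 0 → ∀ c : R, IsUnit c →
      x ^ 2 - algebraMap R F (u : R) * y ^ 2 = z ^ 2 * algebraMap R F c →
      ∃ (n : ℤ) (w : Rˣ), x ^ 2 - algebraMap R F (u : R) * y ^ 2 =
        (algebraMap R F π) ^ (2 * n) * algebraMap R F (w : R) := by
    rintro z hz _ ⟨c, rfl⟩ h
    obtain ⟨n, w, rfl⟩ := exists_zpow_unit_aux R F π hπ z hz
    refine ⟨n, w ^ 2 * c, ?_⟩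
    rw [h, mul_comm 2 n, zpow_mul]
    simp only [Units.val_mul, Units.val_pow_eq_pow_val, map_mul, map_pow]
    rw [show ((algebraMap R F π ^ n) ^ (2 : ℤ)) = (algebraMap R F π ^ n) ^ 2 from zpow_ofNat _ 2]
    ring
  have unit_of : ∀ c : R, IsLocalRing.residue R c ≠ 0 → IsUnit c := fun c hc =>
    (IsLocalRing.residue_ne_zero_iff_isUnit c).1 hc
  by_cases hy : y = 0
  · subst hy
    have hx : x ≠ 0 := by
      rintro rfl
      simp at hxy
    exact key x hx 1 isUnit_one (by simp)
  rcases ValuationRing.isInteger_or_isInteger R (x / y) with ⟨t, ht⟩ | ⟨t, ht⟩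
  · refine key y hy (t ^ 2 - u) (unit_of _ fun h => hu ⟨IsLocalRing.residue R t, ?_⟩) ?_
    · rw [map_sub, map_pow] at h
      exact sub_eq_zero.1 h
    · rw [map_sub, map_pow, ht]
      field_simp
  · by_cases hx : x = 0
    · subst hx
      exact key y hy (-u) u.isUnit.neg (by simp; ring)
    refine key x hx (1 - u * t ^ 2)
      (unit_of _ fun h => hu ⟨IsLocalRing.residue R (u * t), ?_⟩) ?_
    · simp only [map_sub, map_mul, map_pow, map_one] at h ⊢
      linear_combination (-(IsLocalRing.residue R (u : R))) * h
    · rw [map_sub, map_mul, map_pow, ht, map_one]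
      field_simp
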